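/- Assume ω is alternating. Let F = (V_0,…,V_{k−1}) be an isotropic partial flag of type d in V with completion (V̄_0,…,V̄_{2k−1}), let 𝔭_F = {x ∈ 𝔤 : x(V_p) ⊆ V_p for all p}, and let 𝔦 ⊆ 𝔭_F be a linear subspace with [𝔭_F, 𝔦] ⊆ 𝔦. Then there exists an admissible self-dual sequence c such that for every nilpotent x ∈ 𝔤 one has: x ∈ 𝔦 if and only if x(V̄_p) ⊆ V̄_{c_p} for all p = 0,…,2k−1. -/

import Mathlib

open Module Submodule

noncomputable section

/-- The orthogonal `W^⊥ = {v : ω(v,w) = 0 for all w ∈ W}` of a subspace with respect to a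
bilinear form `ω`. -/
def ortho {V : Type*} [AddCommGroup V] [Module ℂ V]
    (ω : V →ₗ[ℂ] V →ₗ[ℂ] ℂ) (W : Submodule ℂ V) : Submodule ℂ V where
  carrier := {v | ∀ w ∈ W, ω v w = 0}
  zero_mem' := by intro w _; simp
  add_mem' := by
    intro a b ha hb w hw
    rw [map_add, LinearMap.add_apply, ha w hw, hb w hw, add_zero]
  smul_mem' := by
    intro t a ha w hw
    rw [map_smul, LinearMap.smul_apply, ha w hw, smul_zero]

/-- The completion `(V̄_0, …, V̄_{2k−1})` of an isotropic partial flag `(V_0, …, V_{k−1})`: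
`V̄_p = V_p` for `p ≤ k−1` and `V̄_p = (V_{2k−1−p})^⊥` for `k ≤ p ≤ 2k−1`. -/
def completion {V : Type*} [AddCommGroup V] [Module ℂ V]
    (ω : V →ₗ[ℂ] V →ₗ[ℂ] ℂ) {k : ℕ} (W : Fin k → Submodule ℂ V) :
    ℕ → Submodule ℂ V := fun p =>
  if h : p < k then W ⟨p, h⟩
  else if h2 : 2 * k - 1 - p < k then ortho ω (W ⟨2 * k - 1 - p, h2⟩) else ⊥

/-- An endomorphism `x` is skew-adjoint with respect to `ω` if `ω(x v, w) = −ω(v, x w)`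
for all `v, w`; this says `x ∈ 𝔤`. -/
def SkewAdjWrt {V : Type*} [AddCommGroup V] [Module ℂ V]
    (ω : V →ₗ[ℂ] V →ₗ[ℂ] ℂ) (x : Module.End ℂ V) : Prop :=
  ∀ v w, ω (x v) w = - ω v (x w)


theorem ortho_ortho {V : Type*} [AddCommGroup V] [Module ℂ V] [FiniteDimensional ℂ V]
    (ω : V →ₗ[ℂ] V →ₗ[ℂ] ℂ) (hnd : ∀ v, (∀ w, ω v w = 0) → v = 0)
    (halt : ∀ v, ω v v = 0) (W : Submodule ℂ V) : ortho ω (ortho ω W) = W := by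
  have hA : LinearMap.BilinForm.IsAlt ω := halt
  have hR : LinearMap.BilinForm.IsRefl ω := hA.isRefl
  have key : ∀ U : Submodule ℂ V, ortho ω U = LinearMap.BilinForm.orthogonal ω U := by
    intro U
    ext v
    rw [LinearMap.BilinForm.mem_orthogonal_iff]
    exact ⟨fun h w hw => hR _ _ (h w hw), fun h w hw => hR _ _ (h w hw)⟩
  have hN : LinearMap.BilinForm.Nondegenerate ω := by
    refine ⟨fun v h => hnd v h, fun v h => hnd v fun w => hR _ _ (h w)⟩
  rw [key, key]
  exact LinearMap.BilinForm.orthogonal_orthogonal hN hR W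

/-- The symmetric square element `w ↦ ω(u,w) v + ω(v,w) u`. -/
def sy {V : Type*} [AddCommGroup V] [Module ℂ V]
    (ω : V →ₗ[ℂ] V →ₗ[ℂ] ℂ) (u v : V) : Module.End ℂ V :=
  (ω u).smulRight v + (ω v).smulRight u

section sylemmas
variable {V : Type*} [AddCommGroup V] [Module ℂ V] (ω : V →ₗ[ℂ] V →ₗ[ℂ] ℂ)

theorem sy_apply (u v w : V) : sy ω u v w = ω u w • v + ω v w • u := by simp [sy]

theorem sy_comm (u v : V) : sy ω u v = sy ω v u := by simp [sy, add_comm]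

theorem sy_add_left (u u' v : V) : sy ω (u + u') v = sy ω u v + sy ω u' v := by
  ext w; simp only [sy_apply, map_add, LinearMap.add_apply]; module

theorem sy_smul_left (t : ℂ) (u v : V) : sy ω (t • u) v = t • sy ω u v := by
  ext w; simp only [sy_apply, map_smul, LinearMap.smul_apply, smul_eq_mul]; module

theorem sy_add_right (u v v' : V) : sy ω u (v + v') = sy ω u v + sy ω u v' := by
  ext w; simp only [sy_apply, map_add, LinearMap.add_apply]; module

theorem sy_smul_right (t : ℂ) (u v : V) : sy ω u (t • v) = t • sy ω u v := by
  ext w; simp only [sy_apply, map_smul, LinearMap.smul_apply, smul_eq_mul]; module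

theorem sy_zero_left (v : V) : sy ω 0 v = 0 := by
  ext w; simp [sy_apply]

theorem om_swap (halt : ∀ v, ω v v = 0) (v w : V) : ω v w = - ω w v := by
  have h := halt (v + w)
  simp only [map_add, LinearMap.add_apply, halt, zero_add, add_zero] at h
  linear_combination h

theorem sy_skew (halt : ∀ v, ω v v = 0) (u v : V) : SkewAdjWrt ω (sy ω u v) := by
  intro a b
  simp only [sy_apply, map_add, map_smul, LinearMap.add_apply, LinearMap.smul_apply, smul_eq_mul]
  rw [om_swap ω halt a v, om_swap ω halt a u]
  ring

theorem comm_sy (y : Module.End ℂ V) (hy : SkewAdjWrt ω y) (u v : V) :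
    y * sy ω u v - sy ω u v * y = sy ω (y u) v + sy ω u (y v) := by
  ext w
  simp only [sy_apply, LinearMap.sub_apply, LinearMap.add_apply, Module.End.mul_apply, map_add,
    map_smul]
  rw [hy u w, hy v w]
  module

end sylemmas

/-- The adjoint action. -/
def ady {V : Type*} [AddCommGroup V] [Module ℂ V] (y : Module.End ℂ V) :
    Module.End ℂ V →ₗ[ℂ] Module.End ℂ V :=
  LinearMap.mulLeft ℂ y - LinearMap.mulRight ℂ y

theorem ady_apply {V : Type*} [AddCommGroup V] [Module ℂ V] (y x : Module.End ℂ V) :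
    ady y x = y * x - x * y := by simp [ady]

/-- Everything about the flag and the ideal that the core argument uses. -/
structure Setup {V : Type*} [AddCommGroup V] [Module ℂ V]
    (ω : V →ₗ[ℂ] V →ₗ[ℂ] ℂ) (N : ℕ) (W : ℕ → Submodule ℂ V)
    (I : Submodule ℂ (Module.End ℂ V)) : Prop where
  halt : ∀ v, ω v v = 0
  mono : ∀ a b, a ≤ b → b < N → W a ≤ W b
  orth : ∀ a b, a < N → b < N → a + b < N → ∀ u ∈ W a, ∀ v ∈ W b, ω u v = 0
  dual : ∀ q < N, ∀ t, t ∉ W q → ∃ u ∈ W (N - 1 - q), ω t u = 1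
  pres : ∀ x ∈ I, ∀ p < N, ∀ w ∈ W p, x w ∈ W p
  skew : ∀ x ∈ I, SkewAdjWrt ω x
  br : ∀ a b, a < N → b < N → a + b ≤ N → ∀ u ∈ W a, ∀ v ∈ W b, ∀ x ∈ I, ady (sy ω u v) x ∈ I

section core
variable {V : Type*} [AddCommGroup V] [Module ℂ V] {ω : V →ₗ[ℂ] V →ₗ[ℂ] ℂ} {N : ℕ}
  {W : ℕ → Submodule ℂ V} {I : Submodule ℂ (Module.End ℂ V)}

theorem ady_sy (halt : ∀ v, ω v v = 0) (p q u v : V) :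
    ady (sy ω p q) (sy ω u v) = sy ω (sy ω p q u) v + sy ω u (sy ω p q v) := by
  rw [ady_apply, comm_sy ω _ (sy_skew ω halt p q)]

theorem Setup.br1 (S : Setup ω N W I) {a b : ℕ} (ha : a < N) (hb : b < N) (hab : a + b ≤ N)
    {u v : V} (hu : u ∈ W a) (hv : v ∈ W b) {x : Module.End ℂ V} (hx : x ∈ I) :
    sy ω (x u) v + sy ω u (x v) ∈ I := by
  have h := S.br a b ha hb hab u hu v hv x hx
  rw [← comm_sy ω x (S.skew x hx)]
  rw [ady_apply] at h
  rw [← neg_sub]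
  exact I.neg_mem h

theorem Setup.br2 (S : Setup ω N W I) {a b : ℕ} (ha : a < N) (hb : b < N) (hab : a + b ≤ N)
    {p q : V} (hp : p ∈ W a) (hq : q ∈ W b) {u v : V} (hx : sy ω u v ∈ I) :
    ω p u • sy ω q v + ω q u • sy ω p v + (ω p v • sy ω u q + ω q v • sy ω u p) ∈ I := by
  have h := S.br a b ha hb hab p hp q hq _ hx
  rw [ady_sy S.halt] at h
  simpa only [sy_apply, sy_add_left, sy_add_right, sy_smul_left, sy_smul_right] using h

theorem Setup.lemP (S : Setup ω N W I) {a b : ℕ} (ha : a < N) (hb : b < N)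
    (ha0 : 0 < a) (hb0 : 0 < b)
    {u v z w : V} (hu : u ∈ W a) (hz : z ∈ W (N - a)) (hv : v ∈ W b) (hw : w ∈ W (N - b))
    (hzu : ω z u = 1) (hwv : ω w v = 1) (huv : ω u v = 0) (huw : ω u w = 0) (hzv : ω z v = 0)
    (hzw : ω z w = 0) {x : Module.End ℂ V} (hx : x ∈ I) (hne : ω (x w) z ≠ 0) :
    sy ω u v ∈ I := by
  have sw := om_swap ω S.halt
  have huz : ω u z = -1 := by rw [sw, hzu]
  have hvw : ω v w = -1 := by rw [sw, hwv]
  have hvu : ω v u = 0 := by rw [sw, huv, neg_zero]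
  have hwu : ω w u = 0 := by rw [sw, huw, neg_zero]
  have hvz : ω v z = 0 := by rw [sw, hzv, neg_zero]
  have hwz : ω w z = 0 := by rw [sw, hzw, neg_zero]
  have hA := S.br1 ha (show N - a < N by omega) (by omega) hu hz hx
  have hB := S.br b (N - b) hb (by omega) (by omega) v hv w hw _ hA
  have eB : ady (sy ω v w) (sy ω (x u) z + sy ω u (x z)) =
      ω v (x u) • sy ω w z + ω w (x u) • sy ω v z + ω v (x z) • sy ω u w
        + ω w (x z) • sy ω u v := by
    simp only [map_add, ady_sy S.halt, sy_apply, sy_add_left, sy_add_right, sy_smul_left,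
      sy_smul_right, hvz, hwz, hvu, hwu]
    module
  rw [eB] at hB
  have hC := S.br a (N - a) ha (by omega) (by omega) u hu z hz _ hB
  have hC' := I.add_mem hB hC
  have eC : (ω v (x u) • sy ω w z + ω w (x u) • sy ω v z + ω v (x z) • sy ω u w
        + ω w (x z) • sy ω u v) + ady (sy ω u z) (ω v (x u) • sy ω w z + ω w (x u) • sy ω v z + ω v (x z) • sy ω u w
        + ω w (x z) • sy ω u v) = (2 * ω v (x z)) • sy ω u w + (2 * ω w (x z)) • sy ω u v := by
    simp only [map_add, map_smul, ady_sy S.halt, sy_apply, sy_add_left, sy_add_right, sy_smul_left,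
      sy_smul_right, hzu, huz, huv, huw, hzv, hzw, S.halt]
    module
  rw [eC] at hC'
  have hD := S.br b (N - b) hb (by omega) (by omega) v hv w hw _ hC'
  have hD' := I.add_mem hC' hD
  have eD : ((2 * ω v (x z)) • sy ω u w + (2 * ω w (x z)) • sy ω u v) +
      ady (sy ω v w) ((2 * ω v (x z)) • sy ω u w + (2 * ω w (x z)) • sy ω u v)
      = (4 * ω w (x z)) • sy ω u v := by
    simp only [map_add, map_smul, ady_sy S.halt, sy_apply, sy_add_left, sy_add_right, sy_smul_left,
      sy_smul_right, hwv, hvw, hvu, hwu, S.halt]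
    module
  rw [eD] at hD'
  refine (I.smul_mem_iff ?_).1 hD'
  have := S.skew x hx w z
  intro h0
  apply hne
  rw [this]
  linear_combination (-1/4) * h0

/-- spreading, case `b < a`. -/
theorem Setup.spread (S : Setup ω N W I) {a b : ℕ} (ha : a < N) (hb : b < N)
    (ha0 : 0 < a) (hb0 : 0 < b) (hba : b < a) (hab : a + b ≤ N)
    {u v z w : V} (hu : u ∈ W a) (hz : z ∈ W (N - a)) (hv : v ∈ W b) (hw : w ∈ W (N - b))
    (hzu : ω z u = 1) (hwv : ω w v = 1) (huv : ω u v = 0) (huw : ω u w = 0) (hzv : ω z v = 0)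
    (hzw : ω z w = 0) (hI : sy ω u v ∈ I) {u' v' : V} (hu' : u' ∈ W a) (hv' : v' ∈ W b)
    (huv' : ω u' v' = 0) : sy ω u' v' ∈ I := by
  have sw := om_swap ω S.halt
  have huz : ω u z = -1 := by rw [sw, hzu]
  have hvw : ω v w = -1 := by rw [sw, hwv]
  have hvu : ω v u = 0 := by rw [sw, huv, neg_zero]
  have hwu : ω w u = 0 := by rw [sw, huw, neg_zero]
  have hvz : ω v z = 0 := by rw [sw, hzv, neg_zero]
  have hwz : ω w z = 0 := by rw [sw, hzw, neg_zero]
  have hWba : ∀ t ∈ W b, t ∈ W a := fun t ht => S.mono b a hba.le ha ht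
  -- first bracket
  have h1 : ∀ t ∈ W a, ω t u • sy ω z v + sy ω t v + ω t v • sy ω u z ∈ I := by
    intro t ht
    have h := S.br2 ha (show N - a < N by omega) (by omega) ht hz hI
    rw [hzu, hzv] at h
    convert h using 1
    module
  have hzvI : ∀ t ∈ W a, ω t u • sy ω z v ∈ I := by
    intro t ht
    by_cases h2 : a + a < N
    · rw [S.orth a a ha ha h2 t ht u hu, zero_smul]; exact I.zero_mem
    · have h := h1 z (S.mono (N - a) a (by omega) ha hz)
      rw [hzu, hzv] at h
      apply I.smul_mem
      refine (I.smul_mem_iff (two_ne_zero (α := ℂ))).1 ?_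
      convert h using 1
      module
  have hX : ∀ t ∈ W a, sy ω t v + ω t v • sy ω u z ∈ I := by
    intro t ht
    have := I.sub_mem (h1 t ht) (hzvI t ht)
    convert this using 1
    module
  have hvv : ∀ s ∈ W b, ω s v = 0 := fun s hs => S.orth b b hb hb (by omega) s hs v hv
  have hvvI : ∀ s ∈ W b, sy ω s v ∈ I := by
    intro s hs
    have := hX s (hWba s hs)
    rwa [hvv s hs, zero_smul, add_zero] at this
  have h2 : ∀ t ∈ W a, ∀ s ∈ W b,
      sy ω t s + ω s t • sy ω w v + (ω t v * ω s u) • sy ω w z ∈ I := by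
    intro t ht s hs
    have h := S.br b (N - b) hb (by omega) (by omega) s hs w hw _ (hX t ht)
    have hsz : ω s z = 0 := S.orth b (N - a) hb (by omega) (by omega) s hs z hz
    have e : ady (sy ω s w) (sy ω t v + ω t v • sy ω u z) =
        sy ω t s + ω s t • sy ω w v + (ω t v * ω s u) • sy ω w z + ω w t • sy ω s v := by
      simp only [map_add, map_smul, ady_sy S.halt, sy_apply, sy_add_left, sy_add_right,
        sy_smul_left, sy_smul_right, hwv, hvv s hs, hwu, hwz, hsz]
      module
    rw [e] at h
    have := I.sub_mem h (I.smul_mem (ω w t) (hvvI s hs))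
    convert this using 1
    module
  have hwzI : (ω u' v * ω v' u) • sy ω w z ∈ I := by
    by_cases h3 : a + b < N
    · rw [S.orth a b ha hb h3 u' hu' v hv, zero_mul, zero_smul]; exact I.zero_mem
    · have e1 : N - b = a := by omega
      have e2 : N - a = b := by omega
      have h := h2 w (e1 ▸ hw) z (e2 ▸ hz)
      rw [hzw, hwv, hzu] at h
      apply I.smul_mem
      refine (I.smul_mem_iff (two_ne_zero (α := ℂ))).1 ?_
      convert h using 1
      module
  have h := h2 u' hu' v' hv'
  rw [sw v' u', huv'] at h
  have := I.sub_mem h hwzI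
  convert this using 1
  module

/-- spreading, case `a = b`. -/
theorem Setup.spreadEq (S : Setup ω N W I) {a : ℕ} (ha : a < N)
    (ha0 : 0 < a) (haa : a + a ≤ N)
    {u z : V} (hu : u ∈ W a) (hz : z ∈ W (N - a)) (hzu : ω z u = 1)
    (hI : sy ω u u ∈ I) {u' v' : V} (hu' : u' ∈ W a) (hv' : v' ∈ W a) : sy ω u' v' ∈ I := by
  have sw := om_swap ω S.halt
  have h1 : ∀ t ∈ W a, ω t u • sy ω z u + sy ω t u ∈ I := by
    intro t ht
    have h := S.br2 ha (show N - a < N by omega) (by omega) ht hz hI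
    rw [hzu, sy_comm ω u z, sy_comm ω u t] at h
    refine (I.smul_mem_iff (two_ne_zero (α := ℂ))).1 ?_
    convert h using 1
    module
  have hX : ∀ t ∈ W a, sy ω t u ∈ I := by
    intro t ht
    have hh : ω t u • sy ω z u ∈ I := by
      by_cases h2 : a + a < N
      · rw [S.orth a a ha ha h2 t ht u hu, zero_smul]; exact I.zero_mem
      · have e : N - a = a := by omega
        have h := h1 z (e ▸ hz)
        rw [hzu] at h
        apply I.smul_mem
        refine (I.smul_mem_iff (two_ne_zero (α := ℂ))).1 ?_
        convert h using 1
        module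
    have := I.sub_mem (h1 t ht) hh
    convert this using 1
    module
  have h2 : ∀ t ∈ W a, ∀ s ∈ W a, sy ω t s + ω s u • sy ω t z + ω s t • sy ω z u ∈ I := by
    intro t ht s hs
    have h := S.br2 ha (show N - a < N by omega) (by omega) hs hz (hX t ht)
    rw [hzu] at h
    have := I.sub_mem h (I.smul_mem (ω z t) (hX s hs))
    convert this using 1
    module
  by_cases h3 : a + a < N
  · have := h2 u' hu' v' hv'
    rwa [S.orth a a ha ha h3 v' hv' u hu, S.orth a a ha ha h3 v' hv' u' hu', zero_smul,
      zero_smul, add_zero, add_zero] at this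
  · have e : N - a = a := by omega
    have hz' : z ∈ W a := e ▸ hz
    have hzu' := hX z hz'
    have h4 : ∀ t ∈ W a, sy ω t z ∈ I := by
      intro t ht
      have h := I.sub_mem (h2 t ht z hz') (I.smul_mem (ω z t) hzu')
      rw [hzu] at h
      refine (I.smul_mem_iff (two_ne_zero (α := ℂ))).1 ?_
      convert h using 1
      module
    have := I.sub_mem (I.sub_mem (h2 u' hu' v' hv') (I.smul_mem (ω v' u) (h4 u' hu')))
      (I.smul_mem (ω v' u') hzu')
    convert this using 1
    module

end core

section core2
variable {V : Type*} [AddCommGroup V] [Module ℂ V] {ω : V →ₗ[ℂ] V →ₗ[ℂ] ℂ} {N : ℕ}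
  {W : ℕ → Submodule ℂ V} {I : Submodule ℂ (Module.End ℂ V)}

theorem Setup.dual' (S : Setup ω N W I) {a : ℕ} (ha : a < N) {t : V} (ht : t ∉ W (N - a - 1)) :
    ∃ u ∈ W a, ω t u = 1 := by
  obtain ⟨u, hu, h⟩ := S.dual (N - a - 1) (by omega) t ht
  have e : N - 1 - (N - a - 1) = a := by omega
  exact ⟨u, e ▸ hu, h⟩

theorem Setup.mainLt (S : Setup ω N W I) {a b : ℕ} (ha : a < N) (hb : b < N)
    (ha0 : 0 < a) (hb0 : 0 < b) (hba : b < a) (hab : a + b ≤ N) {x : Module.End ℂ V} (hx : x ∈ I)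
    {w z : V} (hw : w ∈ W (N - b)) (hz : z ∈ W (N - a)) (hne : ω (x w) z ≠ 0)
    (h1 : ∀ w' ∈ W (N - b - 1), ∀ z' ∈ W (N - a), ω (x w') z' = 0)
    (h2 : ∀ w' ∈ W (N - b), ∀ z' ∈ W (N - a - 1), ω (x w') z' = 0)
    (hd : a + b = N → ω w z = 0) {u' v' : V} (hu' : u' ∈ W a) (hv' : v' ∈ W b)
    (huv' : ω u' v' = 0) : sy ω u' v' ∈ I := by
  have sw := om_swap ω S.halt
  obtain ⟨u, hu, hzu⟩ := S.dual' ha (fun h => hne (h2 w hw z h))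
  obtain ⟨v, hv, hwv⟩ := S.dual' hb (fun h => hne (h1 w h z hz))
  have hWba : ∀ t ∈ W b, t ∈ W a := fun t ht => S.mono b a hba.le ha ht
  have hzb : ∀ t ∈ W b, ω z t = 0 := S.orth (N - a) b (by omega) hb (by omega) z hz
  have hvw : ω v w = -1 := by rw [sw, hwv]
  have huz : ω u z = -1 := by rw [sw, hzu]
  by_cases h3 : a + b < N
  · have huv := S.orth a b ha hb h3
    set u1 := u + ω u w • v with hu1
    have hu1m : u1 ∈ W a := (W a).add_mem hu ((W a).smul_mem _ (hWba v hv))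
    have hzu1 : ω z u1 = 1 := by simp [hu1, hzu, hzb v hv]
    have hu1w : ω u1 w = 0 := by simp [hu1, hvw]
    have hu1m' : u1 ∈ W (N - b - 1) := S.mono a _ (by omega) (by omega) hu1m
    set w1 := w - ω z w • u1 with hw1
    have hw1m : w1 ∈ W (N - b) :=
      (W (N - b)).sub_mem hw ((W (N - b)).smul_mem _ (S.mono a _ (by omega) (by omega) hu1m))
    have hzw1 : ω z w1 = 0 := by simp [hw1, hzu1]
    have hw1v : ω w1 v = 1 := by simp [hw1, hwv, huv u1 hu1m v hv]
    have hu1w1 : ω u1 w1 = 0 := by simp [hw1, hu1w, S.halt]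
    have hne1 : ω (x w1) z ≠ 0 := by
      simpa [hw1, h1 u1 hu1m' z hz] using hne
    have hP := S.lemP ha hb ha0 hb0 hu1m hz hv hw1m hzu1 hw1v (huv u1 hu1m v hv) hu1w1 (hzb v hv)
      hzw1 hx hne1
    exact S.spread ha hb ha0 hb0 hba hab hu1m hz hv hw1m hzu1 hw1v (huv u1 hu1m v hv) hu1w1
      (hzb v hv) hzw1 hP hu' hv' huv'
  · have hN : a + b = N := by omega
    have hwz := hd hN
    have e2 : N - a = b := by omega
    have hzb' : z ∈ W b := e2 ▸ hz
    set v1 := v + ω u v • z with hv1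
    have hv1m : v1 ∈ W b := (W b).add_mem hv ((W b).smul_mem _ hzb')
    have hwv1 : ω w v1 = 1 := by simp [hv1, hwv, hwz]
    have huv1 : ω u v1 = 0 := by simp [hv1, huz]
    have hv1w : ω v1 w = -1 := by rw [sw, hwv1]
    set u1 := u + ω u w • v1 with hu1
    have hu1m : u1 ∈ W a := (W a).add_mem hu ((W a).smul_mem _ (hWba v1 hv1m))
    have hzu1 : ω z u1 = 1 := by simp [hu1, hzu, hzb v1 hv1m]
    have hu1w : ω u1 w = 0 := by simp [hu1, hv1w]
    have hu1v1 : ω u1 v1 = 0 := by simp [hu1, huv1, S.halt]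
    have hzw : ω z w = 0 := by rw [sw, hwz, neg_zero]
    have hP := S.lemP ha hb ha0 hb0 hu1m hz hv1m hw hzu1 hwv1 hu1v1 hu1w (hzb v1 hv1m)
      hzw hx hne
    exact S.spread ha hb ha0 hb0 hba hab hu1m hz hv1m hw hzu1 hwv1 hu1v1 hu1w
      (hzb v1 hv1m) hzw hP hu' hv' huv'

theorem Setup.symx (S : Setup ω N W I) {x : Module.End ℂ V} (hx : x ∈ I) (w z : V) :
    ω (x w) z = ω (x z) w := by
  rw [S.skew x hx w z, om_swap ω S.halt w, neg_neg]

theorem Setup.mainEq (S : Setup ω N W I) {a : ℕ} (ha : a < N)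
    (ha0 : 0 < a) (haa : a + a ≤ N) {x : Module.End ℂ V} (hx : x ∈ I)
    {w z : V} (hw : w ∈ W (N - a)) (hz : z ∈ W (N - a)) (hne : ω (x w) z ≠ 0)
    (h1 : ∀ w' ∈ W (N - a - 1), ∀ z' ∈ W (N - a), ω (x w') z' = 0)
    {u' v' : V} (hu' : u' ∈ W a) (hv' : v' ∈ W a) : sy ω u' v' ∈ I := by
  have sw := om_swap ω S.halt
  obtain ⟨w, hw, hne⟩ : ∃ w ∈ W (N - a), ω (x w) w ≠ 0 := by
    by_contra! hcon
    have e := hcon (w + z) ((W (N - a)).add_mem hw hz)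
    simp only [map_add, LinearMap.add_apply, hcon w hw, hcon z hz, S.symx hx z w] at e
    apply hne
    linear_combination e / 2
  obtain ⟨u, hu, hwu⟩ := S.dual' ha (fun h => hne (h1 w h w hw))
  have huw : ω u w = -1 := by rw [sw, hwu]
  by_cases h3 : a + a < N
  · have hA := S.br1 ha (show N - a < N by omega) (by omega) hu hw hx
    have huxu : ω u (x u) = 0 := S.orth a a ha ha h3 u hu _ (S.pres x hx a ha u hu)
    have hwxu : ω w (x u) = ω u (x w) := by
      rw [sw w, S.symx hx, sw u]
    have hA' := S.br a (N - a) ha (by omega) (by omega) u hu w hw _ hA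
    have hB := I.add_mem hA hA'
    have eB : (sy ω (x u) w + sy ω u (x w)) + ady (sy ω u w) (sy ω (x u) w + sy ω u (x w)) =
        (2 * ω u (x w)) • sy ω u w + ω w (x w) • sy ω u u + (2:ℂ) • sy ω u (x w) := by
      simp only [map_add, ady_sy S.halt, sy_apply, sy_add_left, sy_add_right,
        sy_smul_left, sy_smul_right, hwu, huw, huxu, hwxu, S.halt]
      module
    rw [eB] at hB
    have hC := I.sub_mem (S.br a (N - a) ha (by omega) (by omega) u hu w hw _ hB) hB
    have eC : ady (sy ω u w) ((2 * ω u (x w)) • sy ω u w + ω w (x w) • sy ω u u +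
          (2:ℂ) • sy ω u (x w)) -
        ((2 * ω u (x w)) • sy ω u w + ω w (x w) • sy ω u u + (2:ℂ) • sy ω u (x w)) =
        (3 * ω w (x w)) • sy ω u u := by
      simp only [map_add, map_smul, ady_sy S.halt, sy_apply, sy_add_left, sy_add_right,
        sy_smul_left, sy_smul_right, hwu, huw, huxu, hwxu, S.halt]
      module
    rw [eC] at hC
    have hI : sy ω u u ∈ I := by
      refine (I.smul_mem_iff ?_).1 hC
      intro h0
      apply hne
      rw [sw]
      linear_combination (-1/3) * h0
    exact S.spreadEq ha ha0 haa hu hw hwu hI hu' hv'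
  · have e : N - a = a := by omega
    have hw' : w ∈ W a := e ▸ hw
    have hu2 : -u ∈ W (N - a) := e.symm ▸ (W a).neg_mem hu
    have hA := S.br1 ha ha haa hw' hw' hx
    have hB := S.br a a ha ha haa w hw' w hw' _ hA
    have hI : sy ω w w ∈ I := by
      refine (I.smul_mem_iff (s := 4 * ω w (x w)) ?_).1 ?_
      · intro h0
        apply hne
        rw [sw]
        linear_combination (-1/4) * h0
      · convert hB using 1
        simp only [map_add, ady_sy S.halt, sy_apply, sy_add_left, sy_add_right,
          sy_smul_left, sy_smul_right, S.halt]
        module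
    exact S.spreadEq ha ha0 haa hw' hu2 (by simp [huw]) hI hu' hv'

theorem Setup.main (S : Setup ω N W I) {a b : ℕ} (ha : a < N) (hb : b < N)
    (ha0 : 0 < a) (hb0 : 0 < b) (hab : a + b ≤ N) {x : Module.End ℂ V} (hx : x ∈ I)
    {w z : V} (hw : w ∈ W (N - b)) (hz : z ∈ W (N - a)) (hne : ω (x w) z ≠ 0)
    (h1 : ∀ w' ∈ W (N - b - 1), ∀ z' ∈ W (N - a), ω (x w') z' = 0)
    (h2 : ∀ w' ∈ W (N - b), ∀ z' ∈ W (N - a - 1), ω (x w') z' = 0)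
    (hd : a + b = N → ω w z = 0) {u' v' : V} (hu' : u' ∈ W a) (hv' : v' ∈ W b)
    (huv' : ω u' v' = 0) : sy ω u' v' ∈ I := by
  rcases lt_trichotomy b a with h | h | h
  · exact S.mainLt ha hb ha0 hb0 h hab hx hw hz hne h1 h2 hd hu' hv' huv'
  · subst h
    exact S.mainEq ha ha0 hab hx hw hz hne h1 hu' hv'
  · rw [sy_comm]
    refine S.mainLt hb ha hb0 ha0 h (by omega) hx hz hw (by rwa [S.symx hx])
      (fun w' hw' z' hz' => by rw [S.symx hx]; exact h2 z' hz' w' hw')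
      (fun w' hw' z' hz' => by rw [S.symx hx]; exact h1 z' hz' w' hw')
      (fun h => ?_) hv' hu' ?_
    · rw [om_swap ω S.halt, hd (by omega), neg_zero]
    · rw [om_swap ω S.halt, huv', neg_zero]

end core2

/-- all trace-zero generators of type `(a,b)` lie in `I`. -/
def Tp {V : Type*} [AddCommGroup V] [Module ℂ V] (ω : V →ₗ[ℂ] V →ₗ[ℂ] ℂ)
    (W : ℕ → Submodule ℂ V) (I : Submodule ℂ (Module.End ℂ V)) (a b : ℕ) : Prop :=
  ∀ u ∈ W a, ∀ v ∈ W b, ω u v = 0 → sy ω u v ∈ I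

section core3
variable {V : Type*} [AddCommGroup V] [Module ℂ V] {ω : V →ₗ[ℂ] V →ₗ[ℂ] ℂ} {N : ℕ}
  {W : ℕ → Submodule ℂ V} {I : Submodule ℂ (Module.End ℂ V)}

theorem Setup.fwd (S : Setup ω N W I) (hW0 : W 0 = ⊥)
    (hperp : ∀ (U : Submodule ℂ V) (t : V), t ∉ U → ∃ z ∈ ortho ω U, ω z t ≠ 0)
    (hortho : ∀ q < N, ortho ω (W q) ≤ W (N - 1 - q))
    {x : Module.End ℂ V} (hx : x ∈ I) (hnil : IsNilpotent x) (c : ℕ → ℕ)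
    (hcm : ∀ p q, p ≤ q → q < N → c p ≤ c q) (hcp : ∀ p < N, c p ≤ p)
    (hc : ∀ p < N, ∀ i, 0 < i → i ≤ p → Tp ω W I i (N - p) → i ≤ c p) :
    ∀ p < N, ∀ w ∈ W p, x w ∈ W (c p) := by
  classical
  intro p
  induction p with
  | zero =>
    intro _ w hw
    rw [hW0, Submodule.mem_bot] at hw
    rw [hw, map_zero]
    exact Submodule.zero_mem _
  | succ p ih =>
    intro hp
    have ih := ih (by omega)
    by_contra hcon
    have hex : ∃ i, ∀ w ∈ W (p + 1), x w ∈ W i := ⟨p + 1, S.pres x hx _ hp⟩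
    obtain ⟨i, hi, hmin⟩ : ∃ i, (∀ w ∈ W (p + 1), x w ∈ W i) ∧
        ∀ j < i, ¬ ∀ w ∈ W (p + 1), x w ∈ W j :=
      ⟨Nat.find hex, Nat.find_spec hex, fun j hj => Nat.find_min hex hj⟩
    have hip : i ≤ p + 1 := by
      by_contra hlt
      exact hmin (p + 1) (by omega) (S.pres x hx _ hp)
    have hci : c (p + 1) < i := by
      by_contra hlt
      exact hcon fun w hw => S.mono i _ (by omega) (by have := hcp (p + 1) hp; omega) (hi w hw)
    have hcpp : c p ≤ i - 1 := by have := hcm p (p + 1) (by omega) hp; omega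
    have hnot := hmin (i - 1) (by omega)
    push Not at hnot
    obtain ⟨w0, hw0, hxw0⟩ := hnot
    have eb : N - (N - (p + 1)) = p + 1 := by omega
    have key : ∀ z ∈ W (N - i), ω (x w0) z ≠ 0 → (i = p + 1 → ω w0 z = 0) → False := by
      intro z hz hne hd
      have hT : Tp ω W I i (N - (p + 1)) := by
        intro u hu v hv huv
        refine S.main (a := i) (b := N - (p + 1)) (by omega) (by omega) (by omega) (by omega)
          (by omega) hx (w := w0) (z := z) (eb.symm ▸ hw0) hz hne ?_ ?_ ?_ hu hv huv
        · rw [eb]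
          intro w' hw' z' hz'
          exact S.orth (i - 1) (N - i) (by omega) (by omega) (by omega) _
            (S.mono _ _ hcpp (by omega) (ih w' hw')) _ hz'
        · rw [eb]
          intro w' hw' z' hz'
          exact S.orth i (N - i - 1) (by omega) (by omega) (by omega) _ (hi w' hw') _ hz'
        · intro h
          exact hd (by omega)
      have := hc (p + 1) hp i (by omega) hip hT
      omega
    by_cases hlt : i < p + 1
    · obtain ⟨z, hz, h⟩ := S.dual (i - 1) (by omega) _ hxw0
      have e : N - 1 - (i - 1) = N - i := by omega
      rw [e] at hz
      exact key z hz (by rw [h]; exact one_ne_zero) (fun h => by omega)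
    · have hie : i = p + 1 := by omega
      have e : i - 1 = p := by omega
      rw [e] at hxw0
      have hU : x w0 ∉ W p ⊔ Submodule.span ℂ {w0} := by
        intro hmem
        obtain ⟨m, hm, y, hy, hmy⟩ := Submodule.mem_sup.1 hmem
        obtain ⟨t, rfl⟩ := Submodule.mem_span_singleton.1 hy
        have hpow : ∀ n : ℕ, (x ^ n) w0 - t ^ n • w0 ∈ W p := by
          intro n
          induction n with
          | zero => simp
          | succ n ihn =>
            have h1 := S.pres x hx p (by omega) _ ihn
            have h2 := (W p).add_mem h1 ((W p).smul_mem (t ^ n) hm)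
            convert h2 using 1
            rw [pow_succ' x, Module.End.mul_apply, map_sub, map_smul, ← hmy, pow_succ]
            module
        obtain ⟨n, hn⟩ := hnil
        have h := hpow n
        rw [hn, LinearMap.zero_apply, zero_sub] at h
        have h := (W p).neg_mem h
        rw [neg_neg] at h
        by_cases ht : t = 0
        · rw [ht, zero_smul, add_zero] at hmy
          exact hxw0 (hmy ▸ hm)
        · exact hxw0 (S.pres x hx p (by omega) _
            (((W p).smul_mem_iff (pow_ne_zero n ht)).1 h))
      obtain ⟨z, hz, hne⟩ := hperp _ _ hU
      have hz1 : z ∈ W (N - i) := by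
        have : z ∈ ortho ω (W p) := fun w hw => hz w (Submodule.mem_sup_left hw)
        have := hortho p (by omega) this
        have e : N - 1 - p = N - i := by omega
        rwa [e] at this
      refine key z hz1 ?_ ?_
      · rw [om_swap ω S.halt]; exact neg_ne_zero.2 hne
      · intro _
        rw [om_swap ω S.halt, hz w0 (Submodule.mem_sup_right (Submodule.mem_span_singleton_self w0)),
          neg_zero]

theorem bwd [FiniteDimensional ℂ V] (hN : 0 < N) (hnd : ∀ v, (∀ w, ω v w = 0) → v = 0)
    (halt : ∀ v, ω v v = 0) (hW0 : W 0 = ⊥) (hWt : W (N - 1) = ⊤)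
    (hmono : ∀ a b, a ≤ b → b < N → W a ≤ W b)
    (hperp : ∀ (U : Submodule ℂ V) (t : V), t ∉ U → ∃ z ∈ ortho ω U, ω z t ≠ 0)
    (hortho : ∀ q < N, ortho ω (W q) ≤ W (N - 1 - q))
    {x : Module.End ℂ V} (hsk : SkewAdjWrt ω x) (hnil : IsNilpotent x) (c : ℕ → ℕ)
    (hcp : ∀ p < N, c p ≤ p)
    (hc : ∀ p < N, 0 < p → Tp ω W I (c p) (N - p))
    (hxc : ∀ p < N, ∀ w ∈ W p, x w ∈ W (c p)) : x ∈ I := by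
  classical
  have hpres : ∀ p < N, ∀ w ∈ W p, x w ∈ W p := fun p hp w hw =>
    hmono _ _ (hcp p hp) hp (hxc p hp w hw)
  let P : Module.End ℂ V → Prop := fun f =>
    ∃ g ∈ I, ∀ w w', ω (g w) w' = ω (x (f w)) w' + ω (x (f w')) w
  let Good : Submodule ℂ V → Prop := fun M =>
    ∃ f, P f ∧ (∀ w ∈ M, f w = w) ∧ ∀ w, f w ∈ M
  have step : ∀ p, p + 1 < N → ∀ M : Submodule ℂ V, W p ≤ M → M ≤ W (p + 1) →
      (∀ w ∈ M, x w ∈ M) → Good M → M ≠ W (p + 1) →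
      ∃ M', M < M' ∧ M' ≤ W (p + 1) ∧ (∀ w ∈ M', x w ∈ M') ∧ Good M' := by
    rintro p hp M hpM hMp hMx ⟨f, ⟨g, hgI, hg⟩, hfid, hfM⟩ hne
    obtain ⟨v, hv, hvM⟩ := SetLike.exists_of_lt (lt_of_le_of_ne hMp hne)
    obtain ⟨v1, hv1, hv1M, hxv1⟩ : ∃ v1 ∈ W (p + 1), v1 ∉ M ∧ x v1 ∈ M := by
      have hex : ∃ n, (x ^ n) v ∈ M := by
        obtain ⟨n, hn⟩ := hnil
        exact ⟨n, by rw [hn]; simp⟩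
      have hpos : 0 < Nat.find hex := by
        rw [Nat.find_pos]
        simpa using hvM
      refine ⟨(x ^ (Nat.find hex - 1)) v, ?_, Nat.find_min hex (by omega), ?_⟩
      · generalize Nat.find hex - 1 = n
        induction n with
        | zero => simpa using hv
        | succ n ih => rw [pow_succ', Module.End.mul_apply]; exact hpres _ hp _ ih
      · have := Nat.find_spec hex
        rw [← Module.End.mul_apply, ← pow_succ', Nat.sub_add_cancel hpos]
        exact this
    obtain ⟨z, hz, hzne⟩ := hperp M v1 hv1M
    set u := (ω z v1)⁻¹ • z with hu
    have huM : ∀ m ∈ M, ω u m = 0 := by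
      intro m hm
      rw [hu, map_smul, LinearMap.smul_apply, hz m hm, smul_zero]
    have huv1 : ω u v1 = 1 := by
      rw [hu, map_smul, LinearMap.smul_apply, smul_eq_mul, inv_mul_cancel₀ hzne]
    have huW : u ∈ W (N - (p + 1)) := by
      have h1 : u ∈ ortho ω (W p) := fun w hw => huM w (hpM hw)
      have e : N - (p + 1) = N - 1 - p := by omega
      rw [e]
      exact hortho p (by omega) h1
    set e := v1 - f v1 with he
    have heW : e ∈ W (p + 1) := (W (p + 1)).sub_mem hv1 (hMp (hfM v1))
    have hxe : x e ∈ M := by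
      rw [he, map_sub]
      exact M.sub_mem hxv1 (hMx _ (hfM v1))
    have hsI : sy ω u (x e) ∈ I := by
      rw [sy_comm]
      refine hc (p + 1) hp (by omega) _ (hxc _ hp e heW) u huW ?_
      rw [om_swap ω halt, huM _ hxe, neg_zero]
    have hv1' : v1 ∈ M ⊔ Submodule.span ℂ {v1} :=
      Submodule.mem_sup_right (Submodule.mem_span_singleton_self v1)
    refine ⟨M ⊔ Submodule.span ℂ {v1}, ?_, ?_, ?_, f + (ω u).smulRight e, ?_, ?_, ?_⟩
    · refine lt_of_le_of_ne le_sup_left fun h => hv1M ?_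
      rw [h]; exact hv1'
    · refine sup_le hMp ?_
      rw [Submodule.span_singleton_le_iff_mem]
      exact hv1
    · intro w hw
      obtain ⟨m, hm, y, hy, rfl⟩ := Submodule.mem_sup.1 hw
      obtain ⟨t, rfl⟩ := Submodule.mem_span_singleton.1 hy
      refine Submodule.mem_sup_left ?_
      rw [map_add, map_smul]
      exact M.add_mem (hMx m hm) (M.smul_mem t hxv1)
    · refine ⟨g + sy ω u (x e), I.add_mem hgI hsI, fun w w' => ?_⟩
      simp only [LinearMap.add_apply, map_add, hg w w', sy_apply, LinearMap.smulRight_apply,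
        map_smul, LinearMap.smul_apply, smul_eq_mul]
      ring
    · intro w hw
      obtain ⟨m, hm, y, hy, rfl⟩ := Submodule.mem_sup.1 hw
      obtain ⟨t, rfl⟩ := Submodule.mem_span_singleton.1 hy
      simp only [LinearMap.add_apply, map_add, LinearMap.smulRight_apply, map_smul, hfid m hm,
        huM m hm, huv1, he, smul_eq_mul]
      module
    · intro w
      rw [LinearMap.add_apply, LinearMap.smulRight_apply]
      refine Submodule.add_mem _ (Submodule.mem_sup_left (hfM w)) (Submodule.smul_mem _ _ ?_)
      exact Submodule.sub_mem _ hv1' (Submodule.mem_sup_left (hfM v1))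
  have all : ∀ p < N, Good (W p) := by
    intro p
    induction p with
    | zero =>
      intro _
      refine ⟨0, ⟨0, I.zero_mem, by simp⟩, ?_, by simp⟩
      intro w hw
      rw [hW0, Submodule.mem_bot] at hw
      simp [hw]
    | succ p ih =>
      intro hp
      have ih := ih (by omega)
      let A : Set (Submodule ℂ V) :=
        {M | W p ≤ M ∧ M ≤ W (p + 1) ∧ (∀ w ∈ M, x w ∈ M) ∧ Good M}
      have hA : A.Nonempty :=
        ⟨W p, le_rfl, hmono _ _ (by omega) hp, hpres p (by omega), ih⟩
      obtain ⟨M, ⟨h1, h2, h3, h4⟩, hmax⟩ :=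
        (wellFounded_gt (α := Submodule ℂ V)).has_min A hA
      by_cases hM : M = W (p + 1)
      · rw [← hM]; exact h4
      · obtain ⟨M', hlt, h5, h6, h7⟩ := step p hp M h1 h2 h3 h4 hM
        exact absurd hlt (hmax M' ⟨h1.trans hlt.le, h5, h6, h7⟩)
  obtain ⟨f, ⟨g, hgI, hg⟩, hfid, -⟩ := all (N - 1) (by omega)
  rw [hWt] at hfid
  have hg2 : g = (2 : ℂ) • x := by
    ext w
    rw [← sub_eq_zero]
    apply hnd
    intro w'
    have h := hg w w'
    rw [hfid w trivial, hfid w' trivial, hsk w' w, om_swap ω halt w' (x w), neg_neg] at h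
    simp only [map_sub, LinearMap.sub_apply, LinearMap.smul_apply, map_smul, h, smul_eq_mul]
    ring
  rw [hg2] at hgI
  exact (I.smul_mem_iff two_ne_zero).1 hgI

end core3

/-- For `ω` symplectic: every Lie ideal `𝔦` of
`𝔭_F = {x ∈ 𝔤 : x(V_p) ⊆ V_p}` has the same nilpotent elements as a standard ideal
`𝔦^F_c` for some admissible self-dual sequence `c`. -/
theorem stmt_11 (V : Type*) [AddCommGroup V] [Module ℂ V] [FiniteDimensional ℂ V]
    (m : ℕ) (hdimV : finrank ℂ V = m)
    (ω : V →ₗ[ℂ] V →ₗ[ℂ] ℂ)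
    (hnd : ∀ v, (∀ w, ω v w = 0) → v = 0)
    (halt : ∀ v, ω v v = 0)
    (k : ℕ) (hk : 2 ≤ k)
    (d : Fin k → ℕ) (hd0 : d ⟨0, by omega⟩ = 0) (hdsm : StrictMono d)
    (hdm : 2 * d ⟨k - 1, by omega⟩ ≤ m)
    (F : Fin k → Submodule ℂ V) (hFmono : Monotone F)
    (hFiso : ∀ p, ∀ v ∈ F p, ∀ w ∈ F p, ω v w = 0)
    (hFdim : ∀ p, finrank ℂ (F p) = d p)
    (I : Submodule ℂ (Module.End ℂ V))
    (hIp : ∀ x ∈ I, SkewAdjWrt ω x ∧ ∀ p, (F p).map x ≤ F p)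
    (hIdeal : ∀ y : Module.End ℂ V, SkewAdjWrt ω y → (∀ p, (F p).map y ≤ F p) →
      ∀ x ∈ I, y * x - x * y ∈ I) :
    ∃ c : ℕ → ℕ,
      (∀ p q, p ≤ q → q < 2 * k → c p ≤ c q) ∧
      (∀ p < 2 * k, c p ≤ p) ∧
      (∀ p < 2 * k, c p = ((Finset.Ico 1 (2 * k)).filter fun q => 2 * k - p ≤ c q).card) ∧
      ∀ x : Module.End ℂ V, SkewAdjWrt ω x → IsNilpotent x →
        (x ∈ I ↔ ∀ p < 2 * k, (completion ω F p).map x ≤ completion ω F (c p)) := by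
  classical
  have sw := om_swap ω halt
  have hoo := ortho_ortho ω hnd halt
  have hperp : ∀ (U : Submodule ℂ V) (t : V), t ∉ U → ∃ z ∈ ortho ω U, ω z t ≠ 0 := by
    intro U t ht
    by_contra! hcon
    apply ht
    rw [← hoo U]
    intro z hz
    rw [sw, hcon z hz, neg_zero]
  have hanti : ∀ U U' : Submodule ℂ V, U ≤ U' → ortho ω U' ≤ ortho ω U :=
    fun U U' h v hv w hw => hv w (h hw)
  set W := completion ω F with hW
  set N := 2 * k with hN
  have hWlt : ∀ p (h : p < k), W p = F ⟨p, h⟩ := by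
    intro p h
    rw [hW, completion, dif_pos h]
  have hWge : ∀ p, k ≤ p → ∀ h2 : N - 1 - p < k, W p = ortho ω (F ⟨N - 1 - p, h2⟩) := by
    intro p h h2
    rw [hW, completion, dif_neg (by omega), dif_pos h2]
  have hF0 : F ⟨0, by omega⟩ = ⊥ := by
    rw [← Submodule.finrank_eq_zero (R := ℂ), hFdim, hd0]
  have hW0 : W 0 = ⊥ := by rw [hWlt 0 (by omega), hF0]
  have hWo : ∀ p < N, ortho ω (W p) = W (N - 1 - p) := by
    intro p hp
    by_cases h : p < k
    · rw [hWlt p h, hWge (N - 1 - p) (by omega) (by omega)]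
      congr 3
      omega
    · rw [hWge p (by omega) (by omega), hoo, hWlt (N - 1 - p) (by omega)]
  have hWt : W (N - 1) = ⊤ := by
    have := hWo 0 (by omega)
    rw [Nat.sub_zero] at this
    rw [← this, hW0, eq_top_iff]
    intro v _ w hw
    rw [(Submodule.mem_bot ℂ).1 hw, map_zero]
  have hmono : ∀ a b, a ≤ b → b < N → W a ≤ W b := by
    intro a b hab hb
    by_cases h : b < k
    · rw [hWlt a (by omega), hWlt b h]
      exact hFmono hab
    · by_cases h' : a < k
      · rw [hWlt a h', hWge b (by omega) (by omega)]
        intro v hv w hw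
        rcases le_total a (N - 1 - b) with h3 | h3
        · exact hFiso _ v (hFmono (show (⟨a, h'⟩ : Fin k) ≤ ⟨N - 1 - b, by omega⟩ from h3) hv) w hw
        · exact hFiso _ v hv w (hFmono (show (⟨N - 1 - b, by omega⟩ : Fin k) ≤ ⟨a, h'⟩ from h3) hw)
      · rw [hWge a (by omega) (by omega), hWge b (by omega) (by omega)]
        refine hanti _ _ (hFmono ?_)
        show N - 1 - b ≤ N - 1 - a
        omega
  have horth : ∀ a b, a < N → b < N → a + b < N → ∀ u ∈ W a, ∀ v ∈ W b, ω u v = 0 := by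
    intro a b ha hb hab u hu v hv
    have h1 : u ∈ W (N - 1 - b) := hmono _ _ (by omega) (by omega) hu
    rw [← hWo b hb] at h1
    exact h1 v hv
  have hcompl : ∀ x : Module.End ℂ V, SkewAdjWrt ω x → (∀ p, (F p).map x ≤ F p) →
      ∀ p < N, ∀ w ∈ W p, x w ∈ W p := by
    intro x hx hF p hp w hw
    by_cases h : p < k
    · rw [hWlt p h] at hw ⊢
      exact hF _ (Submodule.mem_map_of_mem hw)
    · rw [hWge p (by omega) (by omega)] at hw ⊢
      intro w' hw'
      rw [hx, hw _ (hF _ (Submodule.mem_map_of_mem hw')), neg_zero]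
  have hdual : ∀ q < N, ∀ t, t ∉ W q → ∃ u ∈ W (N - 1 - q), ω t u = 1 := by
    intro q hq t ht
    obtain ⟨z, hz, hne⟩ := hperp _ t ht
    rw [hWo q hq] at hz
    have hne' : ω t z ≠ 0 := by rw [sw]; exact neg_ne_zero.2 hne
    refine ⟨(ω t z)⁻¹ • z, Submodule.smul_mem _ _ hz, ?_⟩
    rw [map_smul, smul_eq_mul, inv_mul_cancel₀ hne']
  have S : Setup ω N W I := by
    refine ⟨halt, hmono, horth, hdual, fun x hx => hcompl x (hIp x hx).1 (hIp x hx).2,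
      fun x hx => (hIp x hx).1, ?_⟩
    intro a b ha hb hab u hu v hv x hx
    rw [ady_apply]
    refine hIdeal _ (sy_skew ω halt u v) ?_ x hx
    have aux : ∀ a b, a < N → b < N → a + b ≤ N → ∀ u ∈ W a, ∀ v ∈ W b, ∀ p < N, ∀ w ∈ W p,
        ω u w • v ∈ W p := by
      intro a b ha hb hab u hu v hv p hp w hw
      by_cases h : a + p < N
      · rw [horth a p ha hp h u hu w hw, zero_smul]
        exact Submodule.zero_mem _
      · exact Submodule.smul_mem _ _ (hmono b p (by omega) hp hv)
    rintro ⟨p, hp⟩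
    rw [← hWlt p hp]
    rintro _ ⟨w, hw, rfl⟩
    rw [sy_apply]
    exact Submodule.add_mem _ (aux a b ha hb hab u hu v hv p (by omega) w hw)
      (aux b a hb ha (by omega) v hv u hu p (by omega) w hw)
  have hTsymm : ∀ a b, Tp ω W I a b → Tp ω W I b a := by
    intro a b h u hu v hv huv
    rw [sy_comm]
    exact h v hv u hu (by rw [sw, huv, neg_zero])
  have hT0 : ∀ b, Tp ω W I 0 b := by
    intro b u hu v _ _
    rw [hW0, Submodule.mem_bot] at hu
    rw [hu, sy_zero_left]
    exact I.zero_mem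
  have hTm : ∀ a a' b, a' ≤ a → a < N → Tp ω W I a b → Tp ω W I a' b :=
    fun a a' b h ha hT u hu v hv huv => hT u (hmono _ _ h ha hu) v hv huv
  let c : ℕ → ℕ := fun p => Nat.findGreatest (fun i => Tp ω W I i (N - p)) p
  have hcp : ∀ p, c p ≤ p := fun p => Nat.findGreatest_le p
  have hcT : ∀ p, Tp ω W I (c p) (N - p) := fun p =>
    Nat.findGreatest_spec (P := fun i => Tp ω W I i (N - p)) (Nat.zero_le p) (hT0 _)
  have hle : ∀ p < N, ∀ i, i ≤ c p ↔ i ≤ p ∧ Tp ω W I i (N - p) := by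
    intro p hp i
    constructor
    · intro h
      exact ⟨h.trans (hcp p), hTm _ _ _ h (by have := hcp p; omega) (hcT p)⟩
    · rintro ⟨h1, h2⟩
      exact Nat.le_findGreatest h1 h2
  have hcm : ∀ p q, p ≤ q → q < N → c p ≤ c q := by
    intro p q hpq hq
    rcases Nat.eq_zero_or_pos p with rfl | h0
    · have := hcp 0
      omega
    · rw [hle q hq]
      refine ⟨(hcp p).trans hpq, hTsymm _ _ (hTm (N - p) _ _ (by omega) (by omega)
        (hTsymm _ _ (hcT p)))⟩
  refine ⟨c, hcm, fun p _ => hcp p, ?_, ?_⟩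
  · intro p hp
    have hset : ((Finset.Ico 1 N).filter fun q => N - p ≤ c q) = Finset.Ico (N - c p) N := by
      ext q
      simp only [Finset.mem_filter, Finset.mem_Ico]
      have := hcp p
      constructor
      · rintro ⟨⟨hq1, hqN⟩, h⟩
        refine ⟨?_, hqN⟩
        rw [hle q hqN] at h
        have h2 : N - q ≤ c p := by
          rw [hle p hp]
          exact ⟨by omega, hTsymm _ _ h.2⟩
        omega
      · rintro ⟨h, hqN⟩
        refine ⟨⟨by omega, hqN⟩, ?_⟩
        have h2 : N - q ≤ c p := by omega
        rw [hle p hp] at h2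
        rw [hle q hqN]
        exact ⟨by omega, hTsymm _ _ h2.2⟩
    rw [hset, Nat.card_Ico]
    have := hcp p
    omega
  · intro x hsk hnil
    constructor
    · intro hx p hp
      rintro _ ⟨w, hw, rfl⟩
      exact S.fwd hW0 hperp (fun q hq => (hWo q hq).le) hx hnil c hcm (fun p _ => hcp p)
        (fun p hp i _ hi hT => (hle p hp i).2 ⟨hi, hT⟩) p hp w hw
    · intro h
      exact bwd (by omega) hnd halt hW0 hWt hmono hperp (fun q hq => (hWo q hq).le) hsk hnil c
        (fun p _ => hcp p) (fun p _ _ => hcT p)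
        (fun p hp w hw => h p hp (Submodule.mem_map_of_mem hw))
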